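/- Let B > 0. There exists a constant C = C(q, B) > 0 such that for every nonzero h ∈ 𝔽_q[t] and every real X ≥ 1, Σ_{f ∈ 𝔽_q[t], f ≠ 0, deg f ≤ X} τ(f)^B · ⟨(f,h)⟩ / ⟨f⟩ ≤ C · τ(h)^{B+1} · (X + 1)^{2^B}, where (f,h) denotes the monic greatest common divisor of f and h. -/

import Mathlib

open Polynomial
open scoped Classical

noncomputable section

variable (Fq : Type) [Field Fq] [Fintype Fq]

/-- The norm `⟨f⟩ = q^(deg f)` of a polynomial (with `⟨0⟩ = 0`). -/
def pnorm (f : Polynomial Fq) : ℝ :=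
  if f = 0 then 0 else (Fintype.card Fq : ℝ) ^ f.natDegree

/-- The divisor function: the number of monic divisors of `f`. -/
def tauP (f : Polynomial Fq) : ℕ := {d : Polynomial Fq | d.Monic ∧ d ∣ f}.ncard

section Auxiliary

variable {Fq}

lemma pnorm_mul (f g : Polynomial Fq) : pnorm Fq (f * g) = pnorm Fq f * pnorm Fq g := by
  rcases eq_or_ne f 0 with rfl | hf
  · simp [pnorm]
  rcases eq_or_ne g 0 with rfl | hg
  · simp [pnorm]
  simp [pnorm, hf, hg, natDegree_mul hf hg, pow_add]

lemma pnorm_nonneg (f : Polynomial Fq) : 0 ≤ pnorm Fq f := by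
  unfold pnorm; split_ifs <;> positivity

lemma pnorm_pos {f : Polynomial Fq} (hf : f ≠ 0) : 0 < pnorm Fq f := by
  have := Fintype.card_pos (α := Fq)
  rw [pnorm, if_neg hf]; positivity

lemma pnorm_C {c : Fq} (hc : c ≠ 0) : pnorm Fq (C c) = 1 := by
  simp [pnorm, hc]

lemma pnorm_one : pnorm Fq 1 = 1 := by simp [pnorm]

lemma pnorm_pow (f : Polynomial Fq) (k : ℕ) : pnorm Fq (f ^ k) = pnorm Fq f ^ k := by
  induction k with
  | zero => simp [pnorm_one]
  | succ k ih => rw [pow_succ, pnorm_mul, ih, pow_succ]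

lemma finite_natDegree_le (N : ℕ) : {f : Polynomial Fq | f.natDegree ≤ N}.Finite := by
  refine Set.Finite.of_injOn (f := fun f (i : Fin (N + 1)) => f.coeff i)
    (fun _ _ => Set.mem_univ _) ?_ Set.finite_univ
  intro f hf g hg hfg
  ext n
  rcases le_or_gt n N with hn | hn
  · exact congrFun hfg ⟨n, by omega⟩
  · rw [coeff_eq_zero_of_natDegree_lt (lt_of_le_of_lt hf hn),
      coeff_eq_zero_of_natDegree_lt (lt_of_le_of_lt hg hn)]

lemma finite_monic_dvd {f : Polynomial Fq} (hf : f ≠ 0) :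
    {d : Polynomial Fq | d.Monic ∧ d ∣ f}.Finite :=
  (finite_natDegree_le f.natDegree).subset fun _ hd => natDegree_le_of_dvd hd.2 hf

omit [Fintype Fq] in
lemma exists_eq_C_mul_monic {f : Polynomial Fq} (hf : f ≠ 0) :
    ∃ c : Fq, ∃ g : Polynomial Fq, c ≠ 0 ∧ g.Monic ∧ f = C c * g := by
  have hc : f.leadingCoeff ≠ 0 := leadingCoeff_ne_zero.2 hf
  refine ⟨f.leadingCoeff, f * C f.leadingCoeff⁻¹, hc, monic_mul_leadingCoeff_inv hf, ?_⟩
  rw [mul_left_comm, ← C_mul, mul_inv_cancel₀ hc, C_1, mul_one]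

omit [Fintype Fq] in
lemma tauP_C_mul {c : Fq} (hc : c ≠ 0) (f : Polynomial Fq) : tauP Fq (C c * f) = tauP Fq f := by
  have h : IsUnit (C c) := isUnit_C.2 hc.isUnit
  simp only [tauP, h.dvd_mul_left]

lemma tauP_le_of_dvd {d f : Polynomial Fq} (hf : f ≠ 0) (hd : d ∣ f) : tauP Fq d ≤ tauP Fq f :=
  Set.ncard_le_ncard (fun _ he => ⟨he.1, he.2.trans hd⟩) (finite_monic_dvd hf)

lemma tauP_pos {f : Polynomial Fq} (hf : f ≠ 0) : 0 < tauP Fq f :=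
  (Set.ncard_pos (finite_monic_dvd hf)).2 ⟨1, monic_one, one_dvd f⟩

lemma tauP_mul_le {f g : Polynomial Fq} (hf : f ≠ 0) (hg : g ≠ 0) :
    tauP Fq (f * g) ≤ tauP Fq f * tauP Fq g := by
  unfold tauP
  rw [← Set.ncard_prod]
  refine le_trans (Set.ncard_le_ncard ?_ (((finite_monic_dvd hf).prod (finite_monic_dvd hg)).image
    fun p : Polynomial Fq × Polynomial Fq => p.1 * p.2))
    (Set.ncard_image_le ((finite_monic_dvd hf).prod (finite_monic_dvd hg)))
  rintro d ⟨hd, hdvd⟩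
  obtain ⟨a, b, ha, hb, rfl⟩ := exists_dvd_and_dvd_of_dvd_mul hdvd
  obtain ⟨c, a, hc, ham, rfl⟩ := exists_eq_C_mul_monic (left_ne_zero_of_mul hd.ne_zero)
  obtain ⟨e, b, he, hbm, rfl⟩ := exists_eq_C_mul_monic (right_ne_zero_of_mul hd.ne_zero)
  refine ⟨(a, b), ⟨⟨ham, (Dvd.intro_left _ rfl).trans ha⟩, hbm, (Dvd.intro_left _ rfl).trans hb⟩, ?_⟩
  have h1 : c * e = 1 := by
    have := hd
    rw [Monic, leadingCoeff_mul, leadingCoeff_mul, leadingCoeff_mul, ham, hbm] at this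
    simpa using this
  rw [mul_mul_mul_comm, ← C_mul, h1, C_1, one_mul]

omit [Fintype Fq] in
lemma tauP_irreducible_pow_le {P : Polynomial Fq} (hP : Irreducible P) (hm : P.Monic) (k : ℕ) :
    tauP Fq (P ^ k) ≤ k + 1 := by
  have hsub : {d : Polynomial Fq | d.Monic ∧ d ∣ P ^ k} ⊆
      ((Finset.range (k + 1)).image (P ^ ·) : Finset (Polynomial Fq)) := by
    rintro d ⟨hd, hdvd⟩
    obtain ⟨i, hi, hass⟩ := (dvd_prime_pow hP.prime k).1 hdvd
    simp only [Finset.coe_image, Set.mem_image, Finset.coe_range, Set.mem_Iio]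
    exact ⟨i, by omega, (eq_of_monic_of_associated hd (hm.pow i) hass).symm⟩
  calc tauP Fq (P ^ k) ≤ _ := Set.ncard_le_ncard hsub (Finset.finite_toSet _)
    _ = _ := Set.ncard_coe_finset _
    _ ≤ k + 1 := Finset.card_image_le.trans_eq (Finset.card_range _)

/-- The product of the distinct monic irreducibles of degree `n` divides `X ^ q ^ n - X`. -/
lemma card_mul_le_card_pow {n : ℕ} (hn : n ≠ 0) (S : Finset (Polynomial Fq))
    (hS : ∀ P ∈ S, P.Monic ∧ Irreducible P ∧ P.natDegree = n) :
    S.card * n ≤ Fintype.card Fq ^ n := by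
  have hq : 1 < Fintype.card Fq ^ n := Nat.one_lt_pow hn Fintype.one_lt_card
  have hdvd : ∏ P ∈ S, P ∣ (X ^ Fintype.card Fq ^ n - X : Polynomial Fq) := by
    refine Finset.prod_dvd_of_coprime ?_ ?_
    · intro P hP Q hQ hPQ
      refine (hS P hP).2.1.coprime_iff_not_dvd.2 fun h => hPQ ?_
      exact eq_of_monic_of_associated (hS P hP).1 (hS Q hQ).1
        ((hS P hP).2.1.associated_of_dvd (hS Q hQ).2.1 h)
    · intro P hP
      rw [Fintype.card_eq_nat_card]
      exact (hS P hP).2.1.natDegree_dvd_iff_dvd_X_pow_card_pow_sub_X.1 (hS P hP).2.2.dvd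
  have := natDegree_le_of_dvd hdvd (FiniteField.X_pow_card_sub_X_ne_zero _ hq)
  rwa [FiniteField.X_pow_card_sub_X_natDegree_eq _ hq,
    natDegree_prod _ _ fun P hP => (hS P hP).2.1.ne_zero,
    Finset.sum_congr rfl fun P hP => (hS P hP).2.2, Finset.sum_const, smul_eq_mul] at this

/-- Upper bound for a sum over monic irreducibles of degree at most `N`. -/
lemma sum_irreducible_le (N : ℕ) (S : Finset (Polynomial Fq))
    (hS : ∀ P ∈ S, P.Monic ∧ Irreducible P ∧ P.natDegree ≤ N) (φ : ℕ → ℝ) (hφ : ∀ n, 0 ≤ φ n) :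
    ∑ P ∈ S, φ P.natDegree ≤
      ∑ n ∈ Finset.Icc 1 N, (Fintype.card Fq : ℝ) ^ n / n * φ n := by
  rw [← Finset.sum_fiberwise_of_maps_to (t := Finset.Icc 1 N) (g := natDegree) fun P hP =>
    Finset.mem_Icc.2 ⟨(hS P hP).2.1.natDegree_pos, (hS P hP).2.2⟩]
  refine Finset.sum_le_sum fun n hn => ?_
  have hn0 : 0 < n := (Finset.mem_Icc.1 hn).1
  rw [Finset.sum_congr rfl fun P hP => by rw [(Finset.mem_filter.1 hP).2], Finset.sum_const,
    nsmul_eq_mul]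
  refine mul_le_mul_of_nonneg_right ?_ (hφ n)
  rw [le_div_iff₀ (by positivity)]
  exact_mod_cast card_mul_le_card_pow hn0.ne' _ fun P hP =>
    ⟨(hS P (Finset.mem_filter.1 hP).1).1, (hS P (Finset.mem_filter.1 hP).1).2.1,
      (Finset.mem_filter.1 hP).2⟩

lemma sum_irreducible_inv_le (N : ℕ) (S : Finset (Polynomial Fq))
    (hS : ∀ P ∈ S, P.Monic ∧ Irreducible P ∧ P.natDegree ≤ N) :
    ∑ P ∈ S, (pnorm Fq P)⁻¹ ≤ 1 + Real.log N := by
  have hq : (0 : ℝ) < Fintype.card Fq := by exact_mod_cast Fintype.card_pos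
  have h := sum_irreducible_le N S hS (fun n => ((Fintype.card Fq : ℝ) ^ n)⁻¹)
    (fun n => by positivity)
  rw [Finset.sum_congr rfl fun P hP => by rw [pnorm, if_neg (hS P hP).2.1.ne_zero]]
  refine h.trans (le_trans (le_of_eq ?_) (harmonic_le_one_add_log N))
  rw [harmonic_eq_sum_Icc]
  push_cast
  refine Finset.sum_congr rfl fun n hn => ?_
  field_simp

lemma sum_irreducible_inv_sq_le (N : ℕ) (S : Finset (Polynomial Fq))
    (hS : ∀ P ∈ S, P.Monic ∧ Irreducible P ∧ P.natDegree ≤ N) :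
    ∑ P ∈ S, (pnorm Fq P)⁻¹ ^ 2 ≤ 2 := by
  have hq : (2 : ℝ) ≤ Fintype.card Fq := by exact_mod_cast Fintype.one_lt_card (α := Fq)
  have h := sum_irreducible_le N S hS (fun n => ((Fintype.card Fq : ℝ) ^ n)⁻¹ ^ 2)
    (fun n => by positivity)
  rw [Finset.sum_congr rfl fun P hP => by rw [pnorm, if_neg (hS P hP).2.1.ne_zero]]
  refine h.trans ?_
  calc _ ≤ ∑ n ∈ Finset.Icc 1 N, (1 / 2 : ℝ) ^ n := by
        refine Finset.sum_le_sum fun n hn => ?_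
        have hn1 : (1 : ℝ) ≤ n := by exact_mod_cast (Finset.mem_Icc.1 hn).1
        have hle : (2 : ℝ) ^ n ≤ (Fintype.card Fq : ℝ) ^ n := by gcongr
        calc (Fintype.card Fq : ℝ) ^ n / n * ((Fintype.card Fq : ℝ) ^ n)⁻¹ ^ 2
            = (n : ℝ)⁻¹ * ((Fintype.card Fq : ℝ) ^ n)⁻¹ := by field_simp
          _ ≤ 1 * ((2 : ℝ) ^ n)⁻¹ := by
            gcongr
            exact inv_le_one_of_one_le₀ hn1
          _ = _ := by simp
    _ ≤ ∑' n : ℕ, (1 / 2 : ℝ) ^ n :=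
        summable_geometric_two.sum_le_tsum _ fun n _ => by positivity
    _ = 2 := tsum_geometric_two

end Auxiliary

lemma exists_sum_rpow_mul_pow_le (B : ℝ) :
    ∃ K : ℝ, 0 ≤ K ∧ ∀ x : ℝ, 0 ≤ x → x ≤ 1 / 2 → ∀ M : ℕ,
      ∑ k ∈ Finset.range M, ((k : ℝ) + 1) ^ B * x ^ k ≤ 1 + 2 ^ B * x + K * x ^ 2 := by
  have hs : Summable fun k : ℕ => ((k : ℝ) + 3) ^ B * (1 / 2 : ℝ) ^ k := by
    have h1 : Summable fun k : ℕ => ((k : ℝ)) ^ ⌈B⌉₊ * (1 / 2 : ℝ) ^ k :=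
      summable_pow_mul_geometric_of_norm_lt_one _ (by norm_num)
    have h2 := ((summable_nat_add_iff 3).2 h1).mul_left 8
    refine h2.of_nonneg_of_le (fun k => by positivity) fun k => ?_
    have h3 : ((k : ℝ) + 3) ^ B ≤ ((k : ℝ) + 3) ^ ⌈B⌉₊ := by
      rw [← Real.rpow_natCast]
      exact Real.rpow_le_rpow_of_exponent_le (by linarith [k.cast_nonneg (α := ℝ)])
        (Nat.le_ceil B)
    calc _ ≤ ((k : ℝ) + 3) ^ ⌈B⌉₊ * (1 / 2 : ℝ) ^ k := by gcongr
      _ = _ := by push_cast; ring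
  refine ⟨∑' k : ℕ, ((k : ℝ) + 3) ^ B * (1 / 2 : ℝ) ^ k, tsum_nonneg fun k => by positivity,
    fun x hx hx2 M => ?_⟩
  calc _ ≤ ∑ k ∈ Finset.range (M + 2), ((k : ℝ) + 1) ^ B * x ^ k :=
        Finset.sum_le_sum_of_subset_of_nonneg (Finset.range_mono (by omega))
          fun k _ _ => by positivity
    _ = 1 + 2 ^ B * x + (∑ k ∈ Finset.range M, ((k : ℝ) + 3) ^ B * x ^ k) * x ^ 2 := by
        rw [Finset.sum_range_succ', Finset.sum_range_succ', Finset.sum_mul]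
        have : ∀ k : ℕ, ((k + 1 + 1 : ℕ) : ℝ) + 1 = k + 3 := fun k => by push_cast; ring
        simp only [this, pow_add]
        norm_num
        rw [Finset.sum_congr rfl fun k _ => by
          rw [show ((k : ℝ) + 3) ^ B * (x ^ k * x * x) = (k + 3) ^ B * x ^ k * x ^ 2 by ring]]
        ring
    _ ≤ _ := by
        gcongr
        refine le_trans (Finset.sum_le_sum fun k _ => ?_)
          (hs.sum_le_tsum (Finset.range M) fun k _ => by positivity)
        gcongr

section Auxiliary

variable {Fq}

/-- The truncated Euler product bound for sums of `τ(f) ^ B / ⟨f⟩`. -/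
lemma sum_tauP_div_pnorm_le_prod {B : ℝ} (hB : 0 < B) (E : Polynomial Fq → ℝ)
    (S : Finset (Polynomial Fq)) (hS : ∀ P ∈ S, P.Monic ∧ Irreducible P)
    (hE : ∀ P ∈ S, ∀ M : ℕ,
      ∑ k ∈ Finset.range M, ((k : ℝ) + 1) ^ B * (pnorm Fq P)⁻¹ ^ k ≤ E P)
    (T : Finset (Polynomial Fq)) (hT : ∀ f ∈ T, f.Monic)
    (hTS : ∀ f ∈ T, ∀ P : Polynomial Fq, P.Monic → Irreducible P → P ∣ f → P ∈ S) :
    ∑ f ∈ T, (tauP Fq f : ℝ) ^ B / pnorm Fq f ≤ ∏ P ∈ S, E P := by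
  induction S using Finset.induction_on generalizing T with
  | empty =>
    have hT1 : T ⊆ {1} := by
      intro f hf
      rw [Finset.mem_singleton]
      by_contra hne
      obtain ⟨P, hPm, hPi, hPd⟩ :=
        exists_monic_irreducible_factor f (fun h => hne ((hT f hf).eq_one_of_isUnit h))
      simpa using hTS f hf P hPm hPi hPd
    have h1 : tauP Fq 1 ≤ 1 := by
      simpa using tauP_irreducible_pow_le irreducible_X (monic_X (R := Fq)) 0
    have h1' : (tauP Fq 1 : ℝ) ≤ 1 := by exact_mod_cast h1
    calc _ ≤ ∑ f ∈ ({1} : Finset (Polynomial Fq)), (tauP Fq f : ℝ) ^ B / pnorm Fq f :=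
          Finset.sum_le_sum_of_subset_of_nonneg hT1 fun f _ _ =>
            div_nonneg (by positivity) (pnorm_nonneg f)
      _ ≤ _ := by
          simpa [pnorm_one] using Real.rpow_le_one (by positivity) h1' hB.le
  | insert P S hPS ih =>
    obtain ⟨hPm, hPi⟩ := hS P (Finset.mem_insert_self P S)
    have hfac : ∀ f : Polynomial Fq, ∃ k : ℕ, ∃ g : Polynomial Fq,
        f ∈ T → f = P ^ k * g ∧ ¬ P ∣ g := by
      intro f
      by_cases hf : f ∈ T
      · obtain ⟨g, hg⟩ := (FiniteMultiplicity.of_not_isUnit hPi.not_isUnit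
          (hT f hf).ne_zero).exists_eq_pow_mul_and_not_dvd
        exact ⟨_, g, fun _ => hg⟩
      · exact ⟨0, 0, fun h => absurd h hf⟩
    choose k g hkg using hfac
    have hgm : ∀ f ∈ T, (g f).Monic := fun f hf =>
      (hPm.pow (k f)).of_mul_monic_left ((hkg f hf).1 ▸ hT f hf)
    have hsum := ih (fun Q hQ => hS Q (Finset.mem_insert_of_mem hQ))
      (fun Q hQ => hE Q (Finset.mem_insert_of_mem hQ)) (T.image g)
      (by simpa using hgm)
      (by
        simp only [Finset.mem_image]
        rintro _ ⟨f, hf, rfl⟩ Q hQm hQi hQd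
        have h := hTS f hf Q hQm hQi ((hkg f hf).1 ▸ hQd.mul_left _)
        rcases Finset.mem_insert.1 h with rfl | h
        · exact absurd hQd (hkg f hf).2
        · exact h)
    obtain ⟨M, hM⟩ : ∃ M : ℕ, ∀ f ∈ T, k f < M :=
      ⟨T.sup k + 1, fun f hf => Nat.lt_succ_of_le (Finset.le_sup hf)⟩
    have hinj : Set.InjOn (fun f => (k f, g f)) (T : Set (Polynomial Fq)) := by
      intro f hf f' hf' h
      simp only [Prod.mk.injEq] at h
      rw [(hkg f hf).1, (hkg f' hf').1, h.1, h.2]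
    have hEP := hE P (Finset.mem_insert_self P S) M
    let F : ℕ × Polynomial Fq → ℝ := fun p =>
      (((p.1 : ℝ) + 1) ^ B * (pnorm Fq P)⁻¹ ^ p.1) * ((tauP Fq p.2 : ℝ) ^ B / pnorm Fq p.2)
    have hP0 := pnorm_nonneg P
    have hF : ∀ p, 0 ≤ F p := fun p =>
      mul_nonneg (by positivity) (div_nonneg (by positivity) (pnorm_nonneg _))
    calc ∑ f ∈ T, (tauP Fq f : ℝ) ^ B / pnorm Fq f ≤ ∑ f ∈ T, F (k f, g f) := by
          refine Finset.sum_le_sum fun f hf => ?_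
          have hg0 := (hgm f hf).ne_zero
          have ht : tauP Fq f ≤ (k f + 1) * tauP Fq (g f) := by
            conv_lhs => rw [(hkg f hf).1]
            exact (tauP_mul_le (pow_ne_zero _ hPi.ne_zero) hg0).trans
              (Nat.mul_le_mul_right _ (tauP_irreducible_pow_le hPi hPm _))
          have hn : pnorm Fq f = pnorm Fq P ^ k f * pnorm Fq (g f) := by
            conv_lhs => rw [(hkg f hf).1]
            rw [pnorm_mul, pnorm_pow]
          have ht' : (tauP Fq f : ℝ) ≤ (k f + 1) * tauP Fq (g f) := by exact_mod_cast ht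
          calc _ ≤ (((k f : ℝ) + 1) * tauP Fq (g f)) ^ B / pnorm Fq f :=
                div_le_div_of_nonneg_right (Real.rpow_le_rpow (by positivity) ht' hB.le)
                  (pnorm_nonneg f)
            _ = F (k f, g f) := by
                rw [Real.mul_rpow (by positivity) (by positivity), hn]
                simp only [F, inv_pow]
                rw [mul_div_mul_comm, div_eq_mul_inv ((_ : ℝ) ^ B)]
      _ = ∑ p ∈ T.image fun f => (k f, g f), F p := (Finset.sum_image hinj).symm
      _ ≤ ∑ p ∈ Finset.range M ×ˢ T.image g, F p := by
          refine Finset.sum_le_sum_of_subset_of_nonneg ?_ fun p _ _ => hF p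
          intro p hp
          obtain ⟨f, hf, rfl⟩ := Finset.mem_image.1 hp
          exact Finset.mem_product.2
            ⟨Finset.mem_range.2 (hM f hf), Finset.mem_image_of_mem g hf⟩
      _ = (∑ k ∈ Finset.range M, ((k : ℝ) + 1) ^ B * (pnorm Fq P)⁻¹ ^ k) *
            ∑ f ∈ T.image g, (tauP Fq f : ℝ) ^ B / pnorm Fq f := by
          rw [Finset.sum_product, Finset.sum_mul_sum]
      _ ≤ E P * ∏ Q ∈ S, E Q := by
          refine mul_le_mul hEP hsum ?_ ?_
          · exact Finset.sum_nonneg fun f _ => div_nonneg (by positivity) (pnorm_nonneg f)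
          · exact le_trans (Finset.sum_nonneg fun k _ => by positivity) hEP
      _ = _ := (Finset.prod_insert hPS).symm

variable (Fq) in
lemma exists_sum_monic_tauP_div_pnorm_le {B : ℝ} (hB : 0 < B) :
    ∃ K : ℝ, 0 < K ∧ ∀ N : ℕ, N ≠ 0 → ∀ T : Finset (Polynomial Fq),
      (∀ f ∈ T, f.Monic ∧ f.natDegree ≤ N) →
        ∑ f ∈ T, (tauP Fq f : ℝ) ^ B / pnorm Fq f ≤ K * (N : ℝ) ^ ((2 : ℝ) ^ B) := by
  obtain ⟨K, hK, hlocal⟩ := exists_sum_rpow_mul_pow_le B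
  refine ⟨Real.exp (2 ^ B + K * 2), Real.exp_pos _, fun N hN T hT => ?_⟩
  have hfin : {P : Polynomial Fq | P.Monic ∧ Irreducible P ∧ P.natDegree ≤ N}.Finite :=
    (finite_natDegree_le N).subset fun P hP => hP.2.2
  have hS : ∀ P ∈ hfin.toFinset, P.Monic ∧ Irreducible P ∧ P.natDegree ≤ N := fun P hP => by
    simpa using hP
  have hq : (2 : ℝ) ≤ Fintype.card Fq := by exact_mod_cast Fintype.one_lt_card (α := Fq)
  calc _ ≤ ∏ P ∈ hfin.toFinset, Real.exp (2 ^ B * (pnorm Fq P)⁻¹ + K * (pnorm Fq P)⁻¹ ^ 2) := by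
        refine sum_tauP_div_pnorm_le_prod hB _ _ (fun P hP => ⟨(hS P hP).1, (hS P hP).2.1⟩) ?_ T
          (fun f hf => (hT f hf).1) ?_
        · intro P hP M
          have hP2 : 2 ≤ pnorm Fq P := by
            rw [pnorm, if_neg (hS P hP).2.1.ne_zero]
            exact hq.trans (le_self_pow₀ (by linarith) (hS P hP).2.1.natDegree_pos.ne')
          refine (hlocal _ (inv_nonneg.2 (pnorm_nonneg P)) ?_ M).trans ?_
          · rw [one_div]; exact inv_anti₀ two_pos hP2
          · linarith [Real.add_one_le_exp (2 ^ B * (pnorm Fq P)⁻¹ + K * (pnorm Fq P)⁻¹ ^ 2)]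
        · intro f hf P hPm hPi hPd
          simpa using ⟨hPm, hPi, (natDegree_le_of_dvd hPd (hT f hf).1.ne_zero).trans (hT f hf).2⟩
    _ = Real.exp (2 ^ B * ∑ P ∈ hfin.toFinset, (pnorm Fq P)⁻¹ +
          K * ∑ P ∈ hfin.toFinset, (pnorm Fq P)⁻¹ ^ 2) := by
        rw [← Real.exp_sum, Finset.sum_add_distrib, Finset.mul_sum, Finset.mul_sum]
    _ ≤ Real.exp (2 ^ B * (1 + Real.log N) + K * 2) := by
        gcongr
        · exact sum_irreducible_inv_le N _ hS
        · exact sum_irreducible_inv_sq_le N _ hS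
    _ = _ := by
        rw [Real.rpow_def_of_pos (by positivity : (0 : ℝ) < N), ← Real.exp_add]
        congr 1
        ring

/-- Writing `f = c · d · g` with `d` the monic gcd of `f` and `h`, and `c` constant, `g` monic,
reduces the gcd-weighted sum to an unweighted sum over monic polynomials. -/
lemma sum_tauP_mul_pnorm_gcd_le {B : ℝ} (hB : 0 < B) {h : Polynomial Fq} (hh : h ≠ 0) {N : ℕ}
    {K : ℝ} (hK : ∀ T : Finset (Polynomial Fq), (∀ f ∈ T, f.Monic ∧ f.natDegree ≤ N) →
      ∑ f ∈ T, (tauP Fq f : ℝ) ^ B / pnorm Fq f ≤ K)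
    (A : Finset (Polynomial Fq)) (hA : ∀ f ∈ A, f ≠ 0 ∧ f.natDegree ≤ N) :
    ∑ f ∈ A, (tauP Fq f : ℝ) ^ B * pnorm Fq (gcd f h) / pnorm Fq f ≤
      Fintype.card Fq * (tauP Fq h : ℝ) ^ (B + 1) * K := by
  have hfac : ∀ f : Polynomial Fq, ∃ p : Fq × Polynomial Fq × Polynomial Fq, f ∈ A →
      p.1 ≠ 0 ∧ p.2.1.Monic ∧ p.2.2.Monic ∧ f = C p.1 * (p.2.1 * p.2.2) ∧ p.2.1 ∣ h ∧
        pnorm Fq (gcd f h) = pnorm Fq p.2.1 := by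
    intro f
    by_cases hf : f ∈ A
    · obtain ⟨a, d, ha, hd, hgcd⟩ := exists_eq_C_mul_monic (gcd_ne_zero_of_right (a := f) hh)
      have hdf : d ∣ f := (Dvd.intro_left _ hgcd.symm).trans (gcd_dvd_left f h)
      obtain ⟨e, he⟩ := hdf
      obtain ⟨c, g, hc, hg, rfl⟩ := exists_eq_C_mul_monic
        (right_ne_zero_of_mul (he ▸ (hA f hf).1))
      refine ⟨(c, d, g), fun _ => ⟨hc, hd, hg, by rw [he]; ring,
        (Dvd.intro_left _ hgcd.symm).trans (gcd_dvd_right f h), ?_⟩⟩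
      rw [hgcd, pnorm_mul, pnorm_C ha, one_mul]
    · exact ⟨(0, 0, 0), fun h => absurd h hf⟩
  choose p hp using hfac
  have hinj : Set.InjOn p (A : Set (Polynomial Fq)) := by
    intro f hf f' hf' heq
    rw [(hp f hf).2.2.2.1, (hp f' hf').2.2.2.1, heq]
  let T := A.image fun f => (p f).2.2
  let D := (finite_monic_dvd hh).toFinset
  have hD : D.card = tauP Fq h := (Set.ncard_eq_toFinset_card _ _).symm
  have hT : ∀ g ∈ T, g.Monic ∧ g.natDegree ≤ N := by
    intro g hg
    obtain ⟨f, hf, rfl⟩ := Finset.mem_image.1 hg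
    refine ⟨(hp f hf).2.2.1, (natDegree_le_of_dvd ?_ (hA f hf).1).trans (hA f hf).2⟩
    conv_rhs => rw [(hp f hf).2.2.2.1]
    exact (Dvd.intro_left _ rfl).mul_left _
  let F : Fq × Polynomial Fq × Polynomial Fq → ℝ := fun x =>
    (tauP Fq h : ℝ) ^ B * ((tauP Fq x.2.2 : ℝ) ^ B / pnorm Fq x.2.2)
  have hF : ∀ x, 0 ≤ F x := fun x =>
    mul_nonneg (by positivity) (div_nonneg (by positivity) (pnorm_nonneg _))
  have hτ : (tauP Fq h : ℝ) ≠ 0 := by exact_mod_cast (tauP_pos hh).ne'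
  calc _ ≤ ∑ f ∈ A, F (p f) := by
        refine Finset.sum_le_sum fun f hf => ?_
        obtain ⟨hc, hd, hg, hfe, hdh, hgcd⟩ := hp f hf
        have hnd := pnorm_pos hd.ne_zero
        have hng := pnorm_pos hg.ne_zero
        have ht : tauP Fq f ≤ tauP Fq h * tauP Fq (p f).2.2 := by
          conv_lhs => rw [hfe, tauP_C_mul hc]
          exact (tauP_mul_le hd.ne_zero hg.ne_zero).trans
            (Nat.mul_le_mul_right _ (tauP_le_of_dvd hh hdh))
        have hn : pnorm Fq f = pnorm Fq (p f).2.1 * pnorm Fq (p f).2.2 := by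
          conv_lhs => rw [hfe, pnorm_mul, pnorm_C hc, one_mul, pnorm_mul]
        have ht' : (tauP Fq f : ℝ) ≤ tauP Fq h * tauP Fq (p f).2.2 := by exact_mod_cast ht
        rw [hgcd, hn, mul_comm (pnorm Fq _), mul_div_mul_right _ _ hnd.ne']
        simp only [F]
        rw [← mul_div_assoc, ← Real.mul_rpow (by positivity) (by positivity)]
        gcongr
    _ = ∑ x ∈ A.image p, F x := (Finset.sum_image hinj).symm
    _ ≤ ∑ x ∈ Finset.univ ×ˢ D ×ˢ T, F x := by
        refine Finset.sum_le_sum_of_subset_of_nonneg ?_ fun x _ _ => hF x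
        intro x hx
        obtain ⟨f, hf, rfl⟩ := Finset.mem_image.1 hx
        simp only [Finset.mem_product, Finset.mem_univ, true_and]
        exact ⟨by simpa [D] using ⟨(hp f hf).2.1, (hp f hf).2.2.2.2.1⟩,
          Finset.mem_image_of_mem (fun f => (p f).2.2) hf⟩
    _ = Fintype.card Fq * (tauP Fq h : ℝ) ^ (B + 1) *
          ∑ g ∈ T, (tauP Fq g : ℝ) ^ B / pnorm Fq g := by
        simp only [Finset.sum_product, F, ← Finset.mul_sum, Finset.sum_const, hD, nsmul_eq_mul,
          Finset.card_univ, Real.rpow_add_one hτ]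
        ring
    _ ≤ _ := by
        gcongr
        exact hK T hT

end Auxiliary

/-- Rankin-type divisor sum bound:
`Σ_{f ≠ 0, deg f ≤ X} τ(f)^B·⟨(f,h)⟩/⟨f⟩ ≤ C·τ(h)^(B+1)·(X+1)^(2^B)`. -/
theorem rankin_divisor_sum_bound (B : ℝ) (hB : 0 < B) :
    ∃ C : ℝ, 0 < C ∧
      ∀ (h : Polynomial Fq), h ≠ 0 → ∀ X : ℝ, 1 ≤ X →
        ∑ᶠ f ∈ {f : Polynomial Fq | f ≠ 0 ∧ (f.natDegree : ℝ) ≤ X},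
            (tauP Fq f : ℝ) ^ B * pnorm Fq (gcd f h) / pnorm Fq f ≤
          C * (tauP Fq h : ℝ) ^ (B + 1) * (X + 1) ^ ((2 : ℝ) ^ B) := by
  obtain ⟨K, hK, hsum⟩ := exists_sum_monic_tauP_div_pnorm_le Fq hB
  have hq : (0 : ℝ) < Fintype.card Fq := by exact_mod_cast Fintype.card_pos
  refine ⟨Fintype.card Fq * K, by positivity, fun h hh X hX => ?_⟩
  have hX0 : 0 ≤ X := by linarith
  have hN : ⌊X⌋₊ ≠ 0 := (Nat.floor_pos.2 hX).ne'
  have hfin : {f : Polynomial Fq | f ≠ 0 ∧ (f.natDegree : ℝ) ≤ X}.Finite :=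
    (finite_natDegree_le ⌊X⌋₊).subset fun f hf => Nat.le_floor hf.2
  rw [finsum_mem_eq_finite_toFinset_sum _ hfin]
  refine (sum_tauP_mul_pnorm_gcd_le hB hh (hsum ⌊X⌋₊ hN) _ fun f hf => ?_).trans ?_
  · rw [Set.Finite.mem_toFinset] at hf
    exact ⟨hf.1, Nat.le_floor hf.2⟩
  · have hle : (⌊X⌋₊ : ℝ) ^ ((2 : ℝ) ^ B) ≤ (X + 1) ^ ((2 : ℝ) ^ B) := by
      gcongr
      exact (Nat.floor_le hX0).trans (by linarith)
    calc _ = Fintype.card Fq * K * (tauP Fq h : ℝ) ^ (B + 1) * (⌊X⌋₊ : ℝ) ^ ((2 : ℝ) ^ B) := by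
          ring
      _ ≤ _ := by gcongr

end
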